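/- arXiv:math/0403057 — 2 statements merged into one kernel-verified Lean document; each statement's English description precedes it below -/
import Mathlib

section
/- Let S be a conical refinement commutative monoid whose algebraic preorder is antisymmetric, which has general comparability, and in which every element is the sum of a directly finite element and a purely infinite element. For a, b ∈ S, if u, v, and w denote respectively the largest purely infinite elements below a, below b, and below a + b (these exist), then w = u + v. -/
namespace PaperCDS

variable {M : Type*} [AddCommMonoid M]

/-- The algebraic preorder: `a ≤ b` iff `a + c = b` for some `c`. -/
def algLe (a b : M) : Prop := ∃ c : M, a + c = b

/-- `S` is conical if `a + b = 0` implies `a = 0` and `b = 0`. -/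
def Conical (M : Type*) [AddCommMonoid M] : Prop :=
  ∀ a b : M, a + b = 0 → a = 0 ∧ b = 0

/-- The refinement property. -/
def Refinement (M : Type*) [AddCommMonoid M] : Prop :=
  ∀ a₀ a₁ b₀ b₁ : M, a₀ + a₁ = b₀ + b₁ →
    ∃ c₀₀ c₀₁ c₁₀ c₁₁ : M,
      a₀ = c₀₀ + c₀₁ ∧ a₁ = c₁₀ + c₁₁ ∧ b₀ = c₀₀ + c₁₀ ∧ b₁ = c₀₁ + c₁₁

/-- Orthogonality: `a ⊥ b` iff the only `x` with `x ≤ a` and `x ≤ b` is `0`. -/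
def Orth (a b : M) : Prop := ∀ x : M, algLe x a → algLe x b → x = 0

/-- `X^⊥ = {s : s ⊥ x for all x ∈ X}`. -/
def perpSet (X : Set M) : Set M := {s : M | ∀ x ∈ X, Orth s x}

/-- An ideal: a nonempty subset `I` with `a + b ∈ I ↔ a ∈ I ∧ b ∈ I`. -/
def IsIdeal (I : Set M) : Prop :=
  I.Nonempty ∧ ∀ a b : M, a + b ∈ I ↔ a ∈ I ∧ b ∈ I

/-- An additive endomorphism. -/
def IsAddEndo (p : M → M) : Prop :=
  p 0 = 0 ∧ ∀ x y : M, p (x + y) = p x + p y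

/-- A projection: an additive endomorphism `p` such that every `x` can be written
`x = p x + y` with `y` orthogonal to every element of the range of `p`. -/
def IsProjection (p : M → M) : Prop :=
  IsAddEndo p ∧ ∀ x : M, ∃ y : M, x = p x + y ∧ ∀ s : M, Orth y (p s)

/-- A complementary pair of projections. -/
def ComplPair (p q : M → M) : Prop :=
  IsAddEndo p ∧ IsAddEndo q ∧
    ∀ x : M, p x + q x = x ∧ p (q x) = 0 ∧ q (p x) = 0

/-- General comparability. -/
def GenComp (M : Type*) [AddCommMonoid M] : Prop :=
  ∀ a b : M, ∃ p q : M → M, ComplPair p q ∧ algLe (p a) (p b) ∧ algLe (q b) (q a)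

/-- `S` is Boolean-valued. -/
def BoolValued (M : Type*) [AddCommMonoid M] : Prop :=
  ∀ a b : M, ∃ p q : M → M, ComplPair p q ∧ algLe (p a) (p b) ∧
    ∀ p' q' : M → M, ComplPair p' q' → algLe (p' a) (p' b) →
      ∀ x : M, algLe (p' x) (p x)

/-- Directly finite element. -/
def DirectlyFinite (c : M) : Prop := ∀ x : M, x + c = c → x = 0

/-- Purely infinite element. -/
def PurelyInfinite (c : M) : Prop := c + c = c

/-- `b` is an infimum of `X` for the algebraic preorder. -/
def IsInfOf (b : M) (X : Set M) : Prop :=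
  (∀ x ∈ X, algLe b x) ∧ ∀ y : M, (∀ x ∈ X, algLe y x) → algLe y b

/-- `b` is a supremum of `X` for the algebraic preorder. -/
def IsSupOf (b : M) (X : Set M) : Prop :=
  (∀ x ∈ X, algLe x b) ∧ ∀ y : M, (∀ x ∈ X, algLe x y) → algLe b y

/-- Antisymmetry of the algebraic preorder. -/
def Antisymm (M : Type*) [AddCommMonoid M] : Prop :=
  ∀ a b : M, algLe a b → algLe b a → a = b

/-- Axiom (M5): every element is the sum of a directly finite element and a
purely infinite element. -/
def AxiomM5 (M : Type*) [AddCommMonoid M] : Prop :=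
  ∀ a : M, ∃ x y : M, DirectlyFinite x ∧ PurelyInfinite y ∧ a = x + y

/-- Axiom (M2): every nonempty subset has an infimum. -/
def AxiomM2 (M : Type*) [AddCommMonoid M] : Prop :=
  ∀ X : Set M, X.Nonempty → ∃ b : M, IsInfOf b X

/-- `u` is the largest purely infinite element below `a`. -/
def IsLargestPIBelow (u a : M) : Prop :=
  PurelyInfinite u ∧ algLe u a ∧
    ∀ t : M, PurelyInfinite t → algLe t a → algLe t u

theorem algLe.trans {a b c : M} : algLe a b → algLe b c → algLe a c := by
  rintro ⟨x, rfl⟩ ⟨y, rfl⟩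
  exact ⟨x + y, (add_assoc a x y).symm⟩

theorem algLe.add {a b c d : M} : algLe a b → algLe c d → algLe (a + c) (b + d) := by
  rintro ⟨x, rfl⟩ ⟨y, rfl⟩
  exact ⟨x + y, add_add_add_comm a c x y⟩

theorem PurelyInfinite.add {a b : M} (ha : PurelyInfinite a) (hb : PurelyInfinite b) :
    PurelyInfinite (a + b) := by
  unfold PurelyInfinite at *
  rw [add_add_add_comm, ha, hb]

theorem DirectlyFinite.of_algLe {a b : M} (hb : DirectlyFinite b) (h : algLe a b) :
    DirectlyFinite a := by
  obtain ⟨c, rfl⟩ := h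
  intro x hx
  exact hb x (by rw [← add_assoc, hx])

theorem ComplPair.symm {p q : M → M} (h : ComplPair p q) : ComplPair q p :=
  ⟨h.2.1, h.1, fun x => ⟨by rw [add_comm, (h.2.2 x).1], (h.2.2 x).2.2, (h.2.2 x).2.1⟩⟩

/-- If `c = a + e = b + e` is directly finite, then a projection taking `a` below `b`
identifies their images. -/
theorem ComplPair.map_eq_of_add_eq {p q : M → M} (h : ComplPair p q) {a b c e : M}
    (hc : DirectlyFinite c) (ha : c = a + e) (hb : c = b + e) (hle : algLe (p a) (p b)) :
    p a = p b := by
  obtain ⟨r, hr⟩ := hle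
  have hpc : r + p c = p c := by
    conv_rhs => rw [hb, h.1.2, ← hr]
    rw [ha, h.1.2]
    abel
  have hr0 : r = 0 := hc r (by rw [← (h.2.2 c).1, ← add_assoc, hpc])
  rw [← hr, hr0, add_zero]

/-- Directly finite elements are cancellable. -/
theorem DirectlyFinite.add_right_cancel (hRef : Refinement M) (hGC : GenComp M) {a b c : M}
    (hc : DirectlyFinite c) (h : a + c = b + c) : a = b := by
  obtain ⟨d, a₁, b₁, e, ha, hb₁, hb, ha₁⟩ := hRef a c b c h
  obtain ⟨p, q, hpq, hp, hq⟩ := hGC a₁ b₁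
  have hpe := hpq.map_eq_of_add_eq hc ha₁ hb₁ hp
  have hqe := hpq.symm.map_eq_of_add_eq hc hb₁ ha₁ hq
  rw [ha, hb, ← (hpq.2.2 a₁).1, ← (hpq.2.2 b₁).1, hpe, hqe]

theorem DirectlyFinite.add (hRef : Refinement M) (hGC : GenComp M) {a b : M}
    (ha : DirectlyFinite a) (hb : DirectlyFinite b) : DirectlyFinite (a + b) := fun x hx =>
  ha x (hb.add_right_cancel hRef hGC (by rw [add_assoc, hx]))

/-- A purely infinite element below the sum of a directly finite element and a purely
infinite element `z` is below `z`. -/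
theorem PurelyInfinite.algLe_of_algLe_add (hCon : Conical M) (hRef : Refinement M)
    (hGC : GenComp M) {s z w : M} (hs : DirectlyFinite s) (hz : PurelyInfinite z)
    (hw : PurelyInfinite w) (h : algLe w (s + z)) : algLe w z := by
  obtain ⟨c, hc⟩ := h
  obtain ⟨s₀, z₀, s₁, z₁, hw₀, -, hs₀, hz₀⟩ := hRef w c s z hc
  have hs₀f : DirectlyFinite s₀ := hs.of_algLe ⟨s₁, hs₀.symm⟩
  obtain ⟨p, q, hpq, hp, r, hr⟩ := hGC s₀ z
  obtain ⟨⟨-, hpadd⟩, ⟨-, hqadd⟩, hsum⟩ := hpq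
  have absorb : ∀ x, x + q s₀ = q s₀ → x = 0 := fun x hx => hs₀f x (by
    rw [← (hsum s₀).1, add_comm (p s₀), ← add_assoc, hx])
  have hqz : q z = 0 := absorb _ (by
    rw [← hr, ← add_assoc, ← hqadd, hz])
  have hqz₀ : q z₀ = 0 := (hCon (q z₀) (q z₁) (by rw [← hqadd, ← hz₀, hqz])).1
  have hqw : q w = q s₀ := by rw [hw₀, hqadd, hqz₀, add_zero]
  have hqs₀ : q s₀ = 0 := absorb _ (by rw [← hqw, ← hqadd, hw])
  have hpw : p w = w := by simpa [hqw, hqs₀] using (hsum w).1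
  have hpz : p z = z := by simpa [hqz] using (hsum z).1
  have key : algLe (p s₀ + p z₀) (p z + p z) :=
    hp.add ⟨p z₁, by rw [← hpadd, ← hz₀]⟩
  rwa [← hpadd, ← hw₀, hpw, hpz, hz] at key

theorem statement11 (hCon : Conical M) (hRef : Refinement M)
    (hAnti : Antisymm M) (hGC : GenComp M) (hM5 : AxiomM5 M)
    (a b u v w : M)
    (hu : IsLargestPIBelow u a) (hv : IsLargestPIBelow v b)
    (hw : IsLargestPIBelow w (a + b)) :
    w = u + v := by
  obtain ⟨x, u', hx, hu', rfl⟩ := hM5 a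
  obtain ⟨y, v', hy, hv', rfl⟩ := hM5 b
  have hle : algLe w (u' + v') :=
    PurelyInfinite.algLe_of_algLe_add hCon hRef hGC (hx.add hRef hGC hy) (hu'.add hv') hw.1
      (by rw [add_add_add_comm]; exact hw.2.1)
  exact hAnti _ _
    (hle.trans ((hu.2.2 u' hu' ⟨x, add_comm u' x⟩).add (hv.2.2 v' hv' ⟨y, add_comm v' y⟩)))
    (hw.2.2 _ (hu.1.add hv.1) (hu.2.1.add hv.2.1))

end PaperCDS
end

section
/- Let S be a conical refinement commutative monoid whose algebraic preorder is antisymmetric, which has general comparability, is Boolean-valued, and in which every element is the sum of a directly finite element and a purely infinite element. Then for all a, b ∈ S with a ≤ b, the least difference b ∖ a exists: there is c ∈ S with b ≤ a + c and c ≤ x for every x ∈ S with b ≤ a + x; moreover b = a + c. -/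
namespace PaperCDS

variable {M : Type*} [AddCommMonoid M]

theorem algLe_trans {a b c : M} (hab : algLe a b) (hbc : algLe b c) : algLe a c := by
  obtain ⟨u, rfl⟩ := hab
  obtain ⟨v, rfl⟩ := hbc
  exact ⟨u + v, by rw [add_assoc]⟩

theorem algLe_add_right (a b : M) : algLe a (a + b) := ⟨b, rfl⟩

theorem algLe_add_left (a b : M) : algLe a (b + a) := ⟨b, add_comm a b⟩

theorem algLe_add {a b c d : M} (hab : algLe a b) (hcd : algLe c d) :
    algLe (a + c) (b + d) := by
  obtain ⟨u, rfl⟩ := hab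
  obtain ⟨v, rfl⟩ := hcd
  exact ⟨u + v, by rw [add_add_add_comm]⟩

theorem IsAddEndo.map_algLe {p : M → M} (hp : IsAddEndo p) {a b : M} (h : algLe a b) :
    algLe (p a) (p b) := by
  obtain ⟨u, rfl⟩ := h
  exact ⟨p u, (hp.2 a u).symm⟩

theorem Conical.eq_zero_of_algLe (hCon : Conical M) {a b : M} (h : algLe a b) (hb : b = 0) :
    a = 0 := by
  obtain ⟨u, hu⟩ := h
  exact (hCon a u (hu.trans hb)).1

theorem ComplPair.algLe_self {p q : M → M} (h : ComplPair p q) (x : M) : algLe (p x) x :=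
  ⟨q x, (h.2.2 x).1⟩

theorem ComplPair.idem {p q : M → M} (h : ComplPair p q) (x : M) : p (p x) = p x := by
  have := (h.2.2 (p x)).1
  rwa [(h.2.2 x).2.2, add_zero] at this

/-- The composite of two projections is a projection. -/
theorem ComplPair.comp (hCon : Conical M) {p q p' q' : M → M} (h : ComplPair p q)
    (h' : ComplPair p' q') :
    ComplPair (fun x => p' (p x)) (fun x => q x + q' (p x)) := by
  obtain ⟨hp, hq, hc⟩ := id h
  obtain ⟨hp', hq', hc'⟩ := id h'
  refine ⟨⟨?_, fun x y => ?_⟩, ⟨?_, fun x y => ?_⟩, fun x => ⟨?_, ?_, ?_⟩⟩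
  · simp only [hp.1, hp'.1]
  · simp only [hp.2, hp'.2]
  · simp only [hp.1, hq.1, hq'.1, add_zero]
  · simp only [hp.2, hq.2, hq'.2]
    rw [add_add_add_comm]
  · rw [add_left_comm, (hc' (p x)).1, add_comm, (hc x).1]
  · have h₀ : p' (p (q' (p x))) = 0 :=
      hCon.eq_zero_of_algLe (hp'.map_algLe (h.algLe_self _)) (hc' _).2.1
    simp only [hp.2, hp'.2, (hc x).2.1, hp'.1, h₀, add_zero]
  · have h₀ : q (p' (p x)) = 0 :=
      hCon.eq_zero_of_algLe (hq.map_algLe (h'.algLe_self _)) (hc _).2.2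
    have h₁ : q' (p (p' (p x))) = 0 :=
      hCon.eq_zero_of_algLe (hq'.map_algLe (h.algLe_self _)) (hc' _).2.2
    simp only [h₀, h₁, add_zero]

/-- Directly finite elements are cancellable under refinement and general comparability. -/
theorem DirectlyFinite.add_left_cancel (hRef : Refinement M) (hGC : GenComp M) {c a b : M}
    (hc : DirectlyFinite c) (h : c + a = c + b) : a = b := by
  obtain ⟨x, y, z, w, hxy, rfl, hxz, rfl⟩ := hRef _ _ _ _ h
  obtain ⟨p, q, ⟨hp, hq, hpq⟩, ⟨d, hd⟩, ⟨e, he⟩⟩ := hGC y z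
  have hd₀ : d = 0 := by
    apply hc
    have hpc : d + p c = p c := by
      conv_rhs => rw [hxz, hp.2, ← hd]
      rw [hxy, hp.2]
      abel
    calc d + c = (d + p c) + q c := by rw [add_assoc, (hpq c).1]
      _ = c := by rw [hpc, (hpq c).1]
  have he₀ : e = 0 := by
    apply hc
    have hqc : e + q c = q c := by
      conv_rhs => rw [hxy, hq.2, ← he]
      rw [hxz, hq.2]
      abel
    calc e + c = p c + (e + q c) := by rw [add_left_comm, (hpq c).1]
      _ = c := by rw [hqc, (hpq c).1]
  have hyz : y = z := by
    rw [← (hpq y).1, ← (hpq z).1, ← hd, ← he, hd₀, he₀, add_zero, add_zero]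
  rw [hyz]

theorem PurelyInfinite.map {p : M → M} (hp : IsAddEndo p) {w : M} (hw : PurelyInfinite w) :
    PurelyInfinite (p w) := by
  rw [PurelyInfinite, ← hp.2, hw]

theorem PurelyInfinite.add_eq_of_algLe {w x : M} (hw : PurelyInfinite w) (h : algLe w x) :
    w + x = x := by
  obtain ⟨s, rfl⟩ := h
  rw [← add_assoc, hw]

/-- The least `c` with `w + t ≤ w + c` exists if `w` is purely infinite. -/
theorem PurelyInfinite.exists_least_difference (hCon : Conical M) (hAnti : Antisymm M)
    (hGC : GenComp M) (hBV : BoolValued M) {w : M} (hw : PurelyInfinite w) (t : M) :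
    ∃ c : M, w + t = w + c ∧ ∀ x : M, algLe (w + t) (w + x) → algLe c x := by
  obtain ⟨p, q, hpq, hpt, hmax⟩ := hBV t w
  obtain ⟨hp, hq, hc⟩ := id hpq
  refine ⟨q t, ?_, fun x hx => ?_⟩
  · have h₁ : p w + p t = p w := by
      refine hAnti _ _ ?_ (algLe_add_right _ _)
      have := algLe_add (algLe_add_right (p w) 0) hpt
      rwa [add_zero, hw.map hp] at this
    calc w + t = (p w + q w) + (p t + q t) := by rw [(hc w).1, (hc t).1]
      _ = (p w + p t) + (q w + q t) := add_add_add_comm _ _ _ _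
      _ = w + q t := by rw [h₁, ← add_assoc, (hc w).1]
  · obtain ⟨p₂, q₂, h₂, hpx, hqx⟩ := hGC (q x) (q w)
    have ht : algLe (q t) (q w + q x) := by
      rw [← hq.2]
      exact hq.map_algLe (algLe_trans (algLe_add_left t w) hx)
    have hpt₂ : algLe (p₂ (q t)) (p₂ (q w)) := by
      have h₃ := h₂.1.map_algLe ht
      rw [h₂.1.2] at h₃
      have h₄ := algLe_add (algLe_add_right (p₂ (q w)) 0) hpx
      rw [add_zero, (hw.map hq).map h₂.1] at h₄
      exact algLe_trans h₃ h₄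
    have hzero : p₂ (q t) = 0 := by
      have h₃ := hmax _ _ (hpq.symm.comp hCon h₂) hpt₂ t
      have h₄ : q (p₂ (q t)) = 0 :=
        hCon.eq_zero_of_algLe (hq.map_algLe h₃) (hc t).2.2
      have h₅ : p (p₂ (q t)) = 0 :=
        hCon.eq_zero_of_algLe (hp.map_algLe (h₂.algLe_self _)) (hc t).2.1
      rw [← (hc (p₂ (q t))).1, h₄, h₅, add_zero]
    have hqt : algLe (q₂ (q t)) (q₂ (q x)) := by
      have h₃ := h₂.2.1.map_algLe ht
      rwa [h₂.2.1.2, ((hw.map hq).map h₂.2.1).add_eq_of_algLe hqx] at h₃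
    rw [← (h₂.2.2 (q t)).1, hzero, zero_add]
    exact algLe_trans hqt (algLe_trans (h₂.symm.algLe_self _) (hpq.symm.algLe_self _))

theorem statement12 (hCon : Conical M) (hRef : Refinement M)
    (hAnti : Antisymm M) (hGC : GenComp M) (hBV : BoolValued M)
    (hM5 : AxiomM5 M) :
    ∀ a b : M, algLe a b →
      ∃ c : M, algLe b (a + c) ∧ (∀ x : M, algLe b (a + x) → algLe c x) ∧
        b = a + c := by
  rintro a b ⟨t, rfl⟩
  obtain ⟨f, w, hf, hw, rfl⟩ := hM5 a
  obtain ⟨c, hc, hmin⟩ := hw.exists_least_difference hCon hAnti hGC hBV t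
  have heq : f + w + t = f + w + c := by rw [add_assoc, hc, add_assoc]
  refine ⟨c, ⟨0, by rw [add_zero, heq]⟩, ?_, heq⟩
  rintro x ⟨s, hs⟩
  refine hmin x ⟨s, hf.add_left_cancel hRef hGC ?_⟩
  simpa only [add_assoc] using hs

end PaperCDS
end
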